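/- The map ψ̂ is contracting: for every w ∈ F there exists a natural number k such that the k-th iterate ψ̂^{∘k}(w) lies in the finite set N = {1, x, y, x⁻¹, y⁻¹, xy, y⁻¹x⁻¹}. -/

import Mathlib

/-- F is the free group on two generators x and y. -/
abbrev F : Type := FreeGroup Bool

def x : F := FreeGroup.of false
def y : F := FreeGroup.of true

/-- The homomorphism F → ℤ/2ℤ sending x ↦ 0 and y ↦ 1. -/
def toZ2 : F →* Multiplicative (ZMod 2) :=
  FreeGroup.lift fun s => Multiplicative.ofAdd (if s then (1 : ZMod 2) else 0)

/-- H is the kernel: the elements whose total exponent sum in y is even. -/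
def H : Subgroup F := toZ2.ker

/-- The symmetric generating set of `F` consisting of `x`, `y`, `x * y` and their inverses. -/
def letters : Set F := {x, x⁻¹, y, y⁻¹, x * y, (x * y)⁻¹}

/-- `LengthLE n w` says that `w` is a product of at most `n` elements of `letters`. -/
inductive LengthLE : ℕ → F → Prop
  | one (n : ℕ) : LengthLE n 1
  | mul {n : ℕ} {v s : F} : LengthLE n v → s ∈ letters → LengthLE (n + 1) (v * s)

namespace LengthLE

theorem succ {n : ℕ} {w : F} (h : LengthLE n w) : LengthLE (n + 1) w := by
  induction h with
  | one n => exact one _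
  | mul _ hs ih => exact ih.mul hs

theorem exists_mul (w : F) : ∀ {n : ℕ} {v : F}, LengthLE n v → ∃ m, LengthLE m (v * w) := by
  induction w using FreeGroup.induction_on with
  | C1 => exact fun h => ⟨_, by simpa using h⟩
  | of b => cases b <;> exact fun h => ⟨_, h.mul (by simp [letters, x, y])⟩
  | inv_of b _ => cases b <;> exact fun h => ⟨_, h.mul (by simp [letters, x, y])⟩
  | mul a b iha ihb =>
    intro n v h
    obtain ⟨m, hm⟩ := iha h
    simpa [mul_assoc] using ihb hm

theorem exists_lengthLE (w : F) : ∃ n, LengthLE n w := by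
  simpa using exists_mul w (one 0)

end LengthLE

/-- The recursion rules for `ψ̂`, read off from the last letters of a word. -/
structure IsSectionMap (f : F → F) : Prop where
  map_one : f 1 = 1
  map_y : f y = 1
  map_mul_x : ∀ v, f (v * x) = f v * y
  map_mul_x_mul_y : ∀ v, f (v * x * y) = f (v * y)
  map_mul_y_mul_y : ∀ v, f (v * y * y) = f v * (x * y)⁻¹

namespace IsSectionMap

variable {f : F → F}

theorem map_mul_x_inv (hf : IsSectionMap f) (v : F) : f (v * x⁻¹) = f v * y⁻¹ := by
  simpa using congrArg (· * y⁻¹) (hf.map_mul_x (v * x⁻¹)).symm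

theorem map_mul_x_inv_mul_y (hf : IsSectionMap f) (v : F) : f (v * x⁻¹ * y) = f (v * y) := by
  simpa using (hf.map_mul_x_mul_y (v * x⁻¹)).symm

theorem map_mul_y_inv (hf : IsSectionMap f) (v : F) : f (v * y⁻¹) = f (v * y) * (x * y) := by
  have h := hf.map_mul_y_mul_y (v * y⁻¹)
  rw [inv_mul_cancel_right] at h
  rw [h, inv_mul_cancel_right]

theorem map_mul_xy_inv (hf : IsSectionMap f) (v : F) : f (v * (x * y)⁻¹) = f (v * y) * x := by
  rw [mul_inv_rev, ← mul_assoc, hf.map_mul_x_inv, hf.map_mul_y_inv]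
  group

theorem map_mul_xy (hf : IsSectionMap f) (v : F) : f (v * (x * y)) = f (v * y) := by
  rw [← mul_assoc, hf.map_mul_x_mul_y]

theorem lengthLE_map (hf : IsSectionMap f) {n : ℕ} {w : F} (h : LengthLE n w) :
    LengthLE n (f w) ∧ LengthLE n (f (w * y)) := by
  induction h with
  | one n => simpa [hf.map_one, hf.map_y] using LengthLE.one n
  | @mul n v s _ hs ih =>
    obtain ⟨ih₀, ih₁⟩ := ih
    rcases hs with rfl | rfl | rfl | rfl | rfl | rfl
    · rw [hf.map_mul_x, hf.map_mul_x_mul_y]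
      exact ⟨ih₀.mul (by simp [letters]), ih₁.succ⟩
    · rw [hf.map_mul_x_inv, hf.map_mul_x_inv_mul_y]
      exact ⟨ih₀.mul (by simp [letters]), ih₁.succ⟩
    · rw [hf.map_mul_y_mul_y]
      exact ⟨ih₁.succ, ih₀.mul (by simp [letters])⟩
    · rw [hf.map_mul_y_inv, inv_mul_cancel_right]
      exact ⟨ih₁.mul (by simp [letters]), ih₀.succ⟩
    · have h : f (v * (x * y) * y) = f v * x⁻¹ := by
        rw [← mul_assoc, hf.map_mul_y_mul_y, hf.map_mul_x]
        group
      rw [hf.map_mul_xy, h]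
      exact ⟨ih₁.succ, ih₀.mul (by simp [letters])⟩
    · have h : f (v * (x * y)⁻¹ * y) = f v := by
        rw [mul_inv_rev, ← mul_assoc, hf.map_mul_x_inv_mul_y, inv_mul_cancel_right]
      rw [hf.map_mul_xy_inv, h]
      exact ⟨ih₁.mul (by simp [letters]), ih₀.succ⟩

/-- The last letter of a word is absorbed after at most three applications of `f`. -/
theorem exists_iterate_lengthLE (hf : IsSectionMap f) {n : ℕ} {v s : F} (hv : LengthLE n v)
    (hs : s ∈ letters) :
    ∃ k, LengthLE n (f^[k] (v * s)) := by
  have h₀ {u : F} (hu : LengthLE n u) : LengthLE n (f u) := (hf.lengthLE_map hu).1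
  have h₁ {u : F} (hu : LengthLE n u) : LengthLE n (f (u * y)) := (hf.lengthLE_map hu).2
  rcases hs with rfl | rfl | rfl | rfl | rfl | rfl
  · exact ⟨2, by simpa [hf.map_mul_x] using h₁ (h₀ hv)⟩
  · exact ⟨3, by
      simpa [hf.map_mul_x_inv, hf.map_mul_y_inv, hf.map_mul_xy] using h₁ (h₁ (h₀ hv))⟩
  · exact ⟨1, h₁ hv⟩
  · exact ⟨2, by simpa [hf.map_mul_y_inv, hf.map_mul_xy] using h₁ (h₁ hv)⟩
  · exact ⟨1, by simpa [hf.map_mul_xy] using h₁ hv⟩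
  · refine ⟨3, ?_⟩
    simp only [Function.iterate_succ, Function.iterate_zero, Function.comp_apply, id_eq,
      hf.map_mul_xy_inv, hf.map_mul_x]
    exact h₁ (h₀ (h₁ hv))

theorem exists_iterate_eq_one (hf : IsSectionMap f) (w : F) : ∃ k, f^[k] w = 1 := by
  obtain ⟨n, hn⟩ := LengthLE.exists_lengthLE w
  induction n generalizing w with
  | zero => cases hn; exact ⟨0, rfl⟩
  | succ n ih =>
    cases hn with
    | one => exact ⟨0, rfl⟩
    | mul hv hs =>
      obtain ⟨k, hk⟩ := hf.exists_iterate_lengthLE hv hs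
      obtain ⟨m, hm⟩ := ih _ hk
      exact ⟨m + k, by rw [Function.iterate_add_apply, hm]⟩

end IsSectionMap

theorem toZ2_x : toZ2 x = 1 := by simp [toZ2, x]

theorem toZ2_y : toZ2 y = Multiplicative.ofAdd 1 := by simp [toZ2, y]

theorem x_mem_H : x ∈ H := toZ2_x

theorem y_sq_mem_H : y ^ 2 ∈ H := by
  rw [H, MonoidHom.mem_ker, map_pow, toZ2_y]
  decide

theorem y_notMem_H : y ∉ H := by
  rw [H, MonoidHom.mem_ker, toZ2_y]
  decide

theorem conj_x_mem_H : y⁻¹ * x * y ∈ H := by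
  simp [H, MonoidHom.mem_ker, toZ2_x]

theorem y_inv_mul_mem_H {w : F} (h : w ∉ H) : y⁻¹ * w ∈ H := by
  rw [H, MonoidHom.mem_ker] at *
  rw [map_mul, map_inv, toZ2_y]
  generalize toZ2 w = a at h
  revert a
  decide

/-- The map ψ̂ is contracting: every w ∈ F eventually lands, under iteration of ψ̂,
in the finite set N = {1, x, y, x⁻¹, y⁻¹, xy, y⁻¹x⁻¹}. -/
theorem stmt5 (ψ : H →* F)
    (hψx : ∀ u : H, (u : F) = x → ψ u = y)
    (hψy2 : ∀ u : H, (u : F) = y ^ 2 → ψ u = y⁻¹ * x⁻¹)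
    (hψc : ∀ u : H, (u : F) = y⁻¹ * x * y → ψ u = 1)
    (ψh : F → F)
    (hψh₁ : ∀ (w : F) (h : w ∈ H), ψh w = ψ ⟨w, h⟩)
    (hψh₂ : ∀ (w : F), w ∉ H → ∀ h : y⁻¹ * w ∈ H, ψh w = ψ ⟨y⁻¹ * w, h⟩)
    (w : F) :
    ∃ k : ℕ, ψh^[k] w ∈ ({1, x, y, x⁻¹, y⁻¹, x * y, y⁻¹ * x⁻¹} : Set F) := by
  have hmul (v : F) (u : H) : ψh (v * u) = ψh v * ψ u := by
    by_cases hv : v ∈ H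
    · rw [hψh₁ v hv, hψh₁ _ (mul_mem hv u.2), ← map_mul]
      rfl
    · have hvu : v * u ∉ H := by rwa [H.mul_mem_cancel_right u.2]
      rw [hψh₂ v hv (y_inv_mul_mem_H hv), hψh₂ _ hvu (y_inv_mul_mem_H hvu), ← map_mul]
      congr 1
      exact Subtype.ext (mul_assoc _ _ _).symm
  have hf : IsSectionMap ψh :=
    { map_one := by rw [hψh₁ 1 (one_mem H)]; exact map_one ψ
      map_y := by
        rw [hψh₂ y y_notMem_H (y_inv_mul_mem_H y_notMem_H), ← map_one ψ]
        congr 1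
        exact Subtype.ext (inv_mul_cancel y)
      map_mul_x := fun v => by rw [← hψx ⟨x, x_mem_H⟩ rfl, ← hmul]
      map_mul_x_mul_y := fun v => by
        have h := hmul (v * y) ⟨_, conj_x_mem_H⟩
        rw [hψc _ rfl, mul_one] at h
        rw [← h]
        congr 1
        group
      map_mul_y_mul_y := fun v => by
        rw [mul_inv_rev, ← hψy2 ⟨_, y_sq_mem_H⟩ rfl, ← hmul, mul_assoc, ← pow_two] }
  obtain ⟨k, hk⟩ := hf.exists_iterate_eq_one w
  exact ⟨k, Or.inl hk⟩
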